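/- arXiv:0907.1172 — 3 statements merged into one kernel-verified Lean document; each statement's English description precedes it below -/
import Mathlib

section
/- Let S be a *-separative commutative *-semigroup with a neutral element 0 and let u ∈ S satisfy u = u* and u + u = 0. If the set {s ∈ S : u + s ≠ s} is infinite, then the set {σ ∈ S* : σ(u) = -1} of characters is infinite. -/
open scoped ComplexOrder

/-- `σ : S → ℂ` is a character on the commutative `*`-semigroup `(S, add, st)`:
it is not identically zero, multiplicative and `*`-preserving. -/
def IsChar {S : Type*} (add : S → S → S) (st : S → S) (σ : S → ℂ) : Prop :=
  (∃ s, σ s ≠ 0) ∧ (∀ a b, σ (add a b) = σ a * σ b) ∧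
    (∀ a, σ (st a) = starRingEnd ℂ (σ a))

section IsChar

variable {S : Type*} {add : S → S → S} {st : S → S} {σ τ : S → ℂ}

theorem IsChar.mul (hσ : IsChar add st σ) (hτ : IsChar add st τ) (h : ∃ s, σ s * τ s ≠ 0) :
    IsChar add st (σ * τ) := by
  refine ⟨h, fun a b => ?_, fun a => ?_⟩
  · simp only [Pi.mul_apply, hσ.2.1, hτ.2.1]
    ring
  · simp only [Pi.mul_apply, hσ.2.2, hτ.2.2, map_mul]

theorem IsChar.pow (hσ : IsChar add st σ) (n : ℕ) : IsChar add st (σ ^ n) := by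
  obtain ⟨s, hs⟩ := hσ.1
  refine ⟨⟨s, pow_ne_zero n hs⟩, fun a b => ?_, fun a => ?_⟩
  · simp only [Pi.pow_apply, hσ.2.1, mul_pow]
  · simp only [Pi.pow_apply, hσ.2.2, map_pow]

/-- A character takes the value `1` or `-1` at an element of order two. -/
theorem IsChar.eq_one_or_eq_neg_one (hσ : IsChar add st σ) {z u : S} (hz : ∀ s, add z s = s)
    (hu : add u u = z) : σ u = 1 ∨ σ u = -1 := by
  obtain ⟨s, hs⟩ := hσ.1
  have hσz : σ z = 1 := by
    have h := hσ.2.1 z s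
    rw [hz] at h
    exact mul_right_cancel₀ hs (by rw [← h, one_mul])
  rw [← mul_self_eq_one_iff, ← hσ.2.1, hu, hσz]

end IsChar

/-- A complex function two of whose powers coincide has finite range. -/
theorem finite_range_of_pow_eq_pow {S : Type*} {σ : S → ℂ} {m n : ℕ} (hmn : m ≠ n)
    (h : σ ^ m = σ ^ n) : (Set.range σ).Finite := by
  have hp : (Polynomial.X ^ m - Polynomial.X ^ n : Polynomial ℂ) ≠ 0 := fun h0 => hmn <| by
    simpa using congrArg Polynomial.natDegree (sub_eq_zero.mp h0)
  refine (Polynomial.finite_setOfPred_isRoot hp).subset ?_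
  rintro _ ⟨s, rfl⟩
  simpa [sub_eq_zero] using congrFun h s

/-- Let `S` be a `*`-separative commutative `*`-semigroup with a neutral element `0`
and let `u ∈ S` satisfy `u = u*` and `u + u = 0`.  If the set `{s ∈ S : u+s ≠ s}` is
infinite, then the set `{σ ∈ S* : σ(u) = -1}` of characters is infinite. -/
theorem stmt4 {S : Type*} (add : S → S → S) (st : S → S)
    (hcomm : ∀ a b, add a b = add b a)
    (hassoc : ∀ a b c, add (add a b) c = add a (add b c))
    (hstadd : ∀ a b, st (add a b) = add (st a) (st b))
    (hstinv : ∀ a, st (st a) = a)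
    (z : S) (hz : ∀ s, add z s = s)
    (hsep : ∀ a b : S, a ≠ b → ∃ σ : S → ℂ, IsChar add st σ ∧ σ a ≠ σ b)
    (u : S) (hu1 : st u = u) (hu2 : add u u = z)
    (hinf : {s : S | add u s ≠ s}.Infinite) :
    {σ : S → ℂ | IsChar add st σ ∧ σ u = -1}.Infinite := by
  intro hfin
  set N := {σ : S → ℂ | IsChar add st σ ∧ σ u = -1}
  have hval : ∀ σ : S → ℂ, IsChar add st σ → σ u = 1 ∨ σ u = -1 := fun σ hσ =>
    hσ.eq_one_or_eq_neg_one hz hu2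
  have hrange : ∀ σ ∈ N, (Set.range σ).Finite := by
    intro σ hσ
    have hmem : ∀ k : ℕ, σ ^ (2 * k + 1) ∈ N := fun k =>
      ⟨hσ.1.pow _, by rw [Pi.pow_apply, hσ.2, Odd.neg_one_pow ⟨k, rfl⟩]⟩
    have hni : ¬ Function.Injective fun k : ℕ => σ ^ (2 * k + 1) := fun hi =>
      Set.infinite_of_injective_forall_mem hi hmem hfin
    simp only [Function.Injective, not_forall] at hni
    obtain ⟨k, l, hkl, hne⟩ := hni
    exact finite_range_of_pow_eq_pow (by omega) hkl
  have hnonzero : ∀ s, add u s ≠ s → ∃ σ ∈ N, σ s ≠ 0 := by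
    intro s hs
    obtain ⟨σ, hσ, hne⟩ := hsep _ _ hs
    rw [hσ.2.1] at hne
    rcases hval σ hσ with h | h
    · simp [h] at hne
    · exact ⟨σ, ⟨hσ, h⟩, fun h0 => hne (by simp [h0])⟩
  have hNsep : ∀ s t, add u s ≠ s → s ≠ t → ∃ σ ∈ N, σ s ≠ σ t := by
    intro s t hs hst
    obtain ⟨τ, hτ, hne⟩ := hsep _ _ hst
    rcases hval τ hτ with h | h
    · obtain ⟨σ, hσ, h0⟩ := hnonzero s hs
      by_cases hσst : σ s = σ t
      · refine ⟨σ * τ, ⟨hσ.1.mul hτ ⟨u, by simp [hσ.2, h]⟩, by simp [hσ.2, h]⟩, fun he => hne ?_⟩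
        rw [Pi.mul_apply, Pi.mul_apply, ← hσst] at he
        exact mul_left_cancel₀ h0 he
      · exact ⟨σ, hσ, hσst⟩
    · exact ⟨τ, ⟨hτ, h⟩, hne⟩
  have : Finite N := hfin
  have hpi : (Set.univ.pi fun σ : N => Set.range σ.1).Finite :=
    Set.Finite.pi fun σ => hrange σ.1 σ.2
  have hmaps : Set.MapsTo (fun s (σ : N) => σ.1 s) {s | add u s ≠ s}
      (Set.univ.pi fun σ : N => Set.range σ.1) := fun s _ σ _ => Set.mem_range_self s
  refine hinf (Set.Finite.of_injOn hmaps ?_ hpi)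
  intro s hs t _ hst
  by_contra hne
  obtain ⟨σ, hσ, h⟩ := hNsep s t hs hne
  exact h (congrFun hst ⟨σ, hσ⟩)
end

section
/- Let m ≥ 1, let S = (ℤ/2ℤ)^m with componentwise addition and the identical involution, and let u = (1,0,…,0). For every integer k with 0 ≤ k ≤ 2^{m-1} there exists a positive definite function φ : S → ℂ such that the number of negative squares of s ↦ φ(s+u) is exactly k. -/
open scoped ComplexOrder

/-- `φ : S → ℂ` is positive definite on the commutative `*`-semigroup `(S, add, st)`. -/
def IsPosDefFn {S : Type*} (add : S → S → S) (st : S → S) (φ : S → ℂ) : Prop :=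
  ∀ (n : ℕ) (s : Fin n → S) (ξ : Fin n → ℂ),
    0 ≤ ∑ i, ∑ j, ξ i * starRingEnd ℂ (ξ j) * φ (add (st (s j)) (s i))

/-- number of negative eigenvalues (with multiplicities) of a Hermitian matrix. -/
noncomputable def negEigCount {n : ℕ} {A : Matrix (Fin n) (Fin n) ℂ}
    (hA : A.IsHermitian) : ℕ :=
  (Finset.univ.filter fun i => hA.eigenvalues i < 0).card

/-- The number of negative squares of `ψ` is at most `k`: every Hermitian matrix
`(ψ (sᵢ + sⱼ*))ᵢⱼ` has at most `k` negative eigenvalues, counted with multiplicities. -/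
def NegSquaresLE {S : Type*} (add : S → S → S) (st : S → S) (ψ : S → ℂ) (k : ℕ) : Prop :=
  ∀ (n : ℕ) (s : Fin n → S)
    (h : (Matrix.of fun i j : Fin n => ψ (add (s i) (st (s j)))).IsHermitian),
    negEigCount h ≤ k

/-- `ψ` has a finite number of negative squares. -/
def HasFinNegSquares {S : Type*} (add : S → S → S) (st : S → S) (ψ : S → ℂ) : Prop :=
  ∃ k, NegSquaresLE add st ψ k

/-- The element `u = (1,0,…,0)` of `(ℤ/2ℤ)^m`. -/
def uVec (m : ℕ) : Fin m → ZMod 2 := fun i => if (i : ℕ) = 0 then 1 else 0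

/-- The nontrivial `±1`-valued character of `ZMod 2`. -/
def zmodTwoSign (x : ZMod 2) : ℤ := if x = 0 then 1 else -1

/-- The character of `(ℤ/2ℤ)^m` indexed by `a`. -/
def signChar {m : ℕ} (a s : Fin m → ZMod 2) : ℤ := ∏ i, zmodTwoSign (a i * s i)

theorem zmodTwoSign_mul_add (a x y : ZMod 2) :
    zmodTwoSign (a * (x + y)) = zmodTwoSign (a * x) * zmodTwoSign (a * y) := by
  revert a x y; decide

theorem sum_zmodTwoSign_mul (a b : ZMod 2) :
    ∑ x, zmodTwoSign (a * x) * zmodTwoSign (b * x) = if a = b then 2 else 0 := by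
  revert a b; decide

theorem signChar_add {m : ℕ} (a s t : Fin m → ZMod 2) :
    signChar a (s + t) = signChar a s * signChar a t := by
  simp only [signChar, Pi.add_apply, zmodTwoSign_mul_add, Finset.prod_mul_distrib]

theorem signChar_cons_one_uVec {m : ℕ} (b : Fin m → ZMod 2) :
    signChar (Fin.cons 1 b : Fin (m + 1) → ZMod 2) (uVec (m + 1)) = -1 := by
  simp [signChar, Fin.prod_univ_succ, uVec, zmodTwoSign]

theorem sum_signChar_mul {m : ℕ} (a b : Fin m → ZMod 2) :
    ∑ s, signChar a s * signChar b s = if a = b then 2 ^ m else 0 := by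
  simp only [signChar, ← Finset.prod_mul_distrib]
  rw [← Fintype.prod_sum fun i x => zmodTwoSign (a i * x) * zmodTwoSign (b i * x)]
  simp only [sum_zmodTwoSign_mul]
  split_ifs with h
  · simp [h]
  · obtain ⟨i, hi⟩ := Function.ne_iff.mp h
    exact Finset.prod_eq_zero (Finset.mem_univ i) (if_neg hi)

/-- All nonzero eigenvalues of `-(V * Vᴴ)` are negative, so their number is the rank of `V`. -/
theorem negEigCount_eq_rank {n k : ℕ} {A : Matrix (Fin n) (Fin n) ℂ} (hA : A.IsHermitian)
    (V : Matrix (Fin n) (Fin k) ℂ) (h : A = -(V * V.conjTranspose)) :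
    negEigCount hA = V.rank := by
  have hle (i) : hA.eigenvalues i ≤ 0 := by
    have hpos := (Matrix.posSemidef_self_mul_conjTranspose V).re_dotProduct_nonneg
      (hA.eigenvectorBasis i).ofLp
    rw [← neg_eq_iff_eq_neg.mpr h, Matrix.neg_mulVec, dotProduct_neg, map_neg,
      ← hA.eigenvalues_eq] at hpos
    exact neg_nonneg.mp hpos
  have hrank : A.rank = V.rank := by
    rw [h, ← neg_one_smul ℂ, Matrix.rank_smul_of_mem_nonZeroDivisors _ (by simp),
      Matrix.rank_self_mul_conjTranspose]
  rw [← hrank, hA.rank_eq_card_non_zero_eigs, negEigCount, Fintype.card_subtype]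
  congr 1
  ext i
  simp [lt_iff_le_and_ne, hle i]

/-- A sum of `±1`-valued characters is positive definite. -/
theorem isPosDefFn_sum_signChar {m k : ℕ} (a : Fin k → Fin m → ZMod 2) :
    IsPosDefFn (· + ·) id fun s => ∑ l, (signChar (a l) s : ℂ) := by
  intro n s ξ
  have hsum : ∑ i, ∑ j, ξ i * starRingEnd ℂ (ξ j) * ∑ l, (signChar (a l) (s j + s i) : ℂ) =
      ∑ l, (∑ i, ξ i * (signChar (a l) (s i) : ℂ)) *
        starRingEnd ℂ (∑ j, ξ j * (signChar (a l) (s j) : ℂ)) := by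
    simp only [map_sum, Finset.sum_mul_sum]
    rw [Finset.sum_comm (s := (Finset.univ : Finset (Fin k)))]
    refine Finset.sum_congr rfl fun i _ => ?_
    rw [Finset.sum_comm]
    simp only [Finset.mul_sum]
    refine Finset.sum_congr rfl fun j _ => Finset.sum_congr rfl fun l _ => ?_
    rw [signChar_add, map_mul, map_intCast]
    push_cast
    ring
  simp only [id]
  rw [hsum]
  refine Finset.sum_nonneg fun l _ => ?_
  rw [Complex.mul_conj]
  exact_mod_cast Complex.normSq_nonneg _

/-- Let `m ≥ 1`, `S = (ℤ/2ℤ)^m` with componentwise addition and the identical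
involution, and `u = (1,0,…,0)`.  For every `0 ≤ k ≤ 2^(m-1)` there is a positive
definite `φ : S → ℂ` such that the number of negative squares of `s ↦ φ(s+u)` is
exactly `k`, i.e. all the Hermitian matrices `(φ(sᵢ + sⱼ* + u))ᵢⱼ` have at most `k`
negative eigenvalues and some of them has exactly `k` negative eigenvalues. -/
theorem stmt12 (m : ℕ) (hm : 1 ≤ m) (k : ℕ) (hk : k ≤ 2 ^ (m - 1)) :
    ∃ φ : (Fin m → ZMod 2) → ℂ, IsPosDefFn (· + ·) id φ ∧
      NegSquaresLE (· + ·) id (fun s => φ (s + uVec m)) k ∧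
      ∃ (n : ℕ) (s : Fin n → (Fin m → ZMod 2))
        (h : (Matrix.of fun i j : Fin n =>
          (fun t => φ (t + uVec m)) (s i + id (s j))).IsHermitian),
        negEigCount h = k := by
  obtain ⟨m, rfl⟩ : ∃ p, m = p + 1 := ⟨m - 1, by omega⟩
  obtain ⟨b⟩ : Nonempty (Fin k ↪ (Fin m → ZMod 2)) :=
    Function.Embedding.nonempty_of_card_le (by simpa [ZMod.card] using hk)
  let a : Fin k → Fin (m + 1) → ZMod 2 := fun l => Fin.cons 1 (b l)
  have ha : Function.Injective a := fun i j h => b.injective (Fin.cons_right_injective _ h)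
  let V {n : ℕ} (s : Fin n → Fin (m + 1) → ZMod 2) : Matrix (Fin n) (Fin k) ℂ :=
    Matrix.of fun i l => (signChar (a l) (s i) : ℂ)
  have hV {n : ℕ} (s : Fin n → Fin (m + 1) → ZMod 2) :
      (Matrix.of fun i j : Fin n => ∑ l, (signChar (a l) (s i + s j + uVec (m + 1)) : ℂ)) =
        -(V s * (V s).conjTranspose) := by
    ext i j
    simp [V, a, Matrix.mul_apply, signChar_add, signChar_cons_one_uVec]
  refine ⟨fun s => ∑ l, (signChar (a l) s : ℂ), isPosDefFn_sum_signChar a, fun n s h => ?_, ?_⟩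
  · rw [negEigCount_eq_rank h (V s) (hV s)]
    exact (Matrix.rank_le_width _)
  · let e := (Fintype.equivFin (Fin (m + 1) → ZMod 2)).symm
    have hherm : (-(V e * (V e).conjTranspose)).IsHermitian :=
      (Matrix.isHermitian_mul_conjTranspose_self (V e)).neg
    rw [← hV] at hherm
    refine ⟨_, e, hherm, ?_⟩
    have hgram : (V e).conjTranspose * V e = (2 ^ (m + 1) : ℂ) • 1 := by
      ext l l'
      have hsum := sum_signChar_mul (a l) (a l')
      simp only [← e.sum_comp, ha.eq_iff] at hsum
      simpa [V, Matrix.mul_apply, Matrix.one_apply] using congrArg (Int.cast : ℤ → ℂ) hsum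
    rw [negEigCount_eq_rank hherm (V e) (hV e), ← Matrix.rank_conjTranspose_mul_self, hgram,
      Matrix.rank_smul_of_mem_nonZeroDivisors _ (by simp), Matrix.rank_one, Fintype.card_fin]
end

section
/- Let S be a commutative *-semigroup with a neutral element 0, let u ∈ S satisfy σ(u) = σ(u*) for every character σ on S, and let φ : S → ℂ be positive definite. Then φ(s+u) = conj(φ(s* + u)) for all s ∈ S. -/
open scoped ComplexOrder

open scoped ComplexConjugate

section NullIdeal

variable {A : Type*} [CommRing A] [Algebra ℂ A] {J : A →+* A} {L : A →ₗ[ℂ] ℂ}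

/-- Isotropic vectors of a positive functional lie in its null ideal. -/
theorem isotropic_mem_null (hJJ : ∀ x, J (J x) = x) (hJc : ∀ (c : ℂ) x, J (c • x) = conj c • J x)
    (hpos : ∀ x, 0 ≤ L (x * J x)) {x : A} (hx : L (x * J x) = 0) (g : A) : L (x * g) = 0 := by
  have key : ∀ (t : ℂ) (y : A),
      0 ≤ L (y * J y) + t * L (x * J y) + conj t * L (y * J x) := by
    intro t y
    have h := hpos (y + t • x)
    have e : (y + t • x) * J (y + t • x) =
        y * J y + t • (x * J y) + conj t • (y * J x) + (t * conj t) • (x * J x) := by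
      simp only [map_add, hJc, mul_add, add_mul, smul_mul_assoc, mul_smul_comm]
      module
    rw [e] at h
    simpa [hx] using h
  set y := J g with hy
  have hg : g = J y := by rw [hy, hJJ]
  rw [hg]
  have him : ∀ t : ℂ, (t * L (x * J y) + conj t * L (y * J x)).im = 0 := by
    intro t
    have h0 := (Complex.le_def.1 (hpos y)).2
    have h1 := (Complex.le_def.1 (key t y)).2
    simp only [Complex.add_im, Complex.zero_im] at h0 h1 ⊢
    linarith
  have hre : ∀ t : ℂ, 0 ≤ (L (y * J y)).re + (t * L (x * J y) + conj t * L (y * J x)).re := by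
    intro t
    have h1 := (Complex.le_def.1 (key t y)).1
    simp only [Complex.add_re, Complex.zero_re] at h1 ⊢
    linarith
  have hc : L (y * J x) = conj (L (x * J y)) := by
    have h1 := him 1
    have h2 := him Complex.I
    simp at h1 h2
    apply Complex.ext <;> simp <;> linarith
  rw [hc] at hre
  generalize L (x * J y) = w at hre
  by_contra hw
  have hn : 0 < Complex.normSq w := Complex.normSq_pos.2 hw
  set C := (L (y * J y)).re with hC
  have h := hre (-(((C + 1) / Complex.normSq w : ℝ) : ℂ) * conj w)
  have e : (-(((C + 1) / Complex.normSq w : ℝ) : ℂ) * conj w * w +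
      conj (-(((C + 1) / Complex.normSq w : ℝ) : ℂ) * conj w) * conj w) =
      ((-2 * (C + 1) : ℝ) : ℂ) := by
    have hww : conj w * w = (Complex.normSq w : ℂ) := (Complex.normSq_eq_conj_mul_self).symm
    have hn' : (Complex.normSq w : ℂ) ≠ 0 := by exact_mod_cast hn.ne'
    simp only [map_mul, map_neg, Complex.conj_ofReal, Complex.conj_conj]
    rw [show ∀ r : ℂ, -r * conj w * w + -r * w * conj w = -2 * r * (conj w * w) by
      intro r; ring, hww]
    push_cast
    field_simp
  rw [e, Complex.ofReal_re] at h
  have h0 := (Complex.le_def.1 (hpos y)).1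
  rw [← hC, Complex.zero_re] at h0
  linarith

/-- The null ideal of a positive functional is radical. -/
theorem null_of_pow_null (hJJ : ∀ x, J (J x) = x) (hJc : ∀ (c : ℂ) x, J (c • x) = conj c • J x)
    (hpos : ∀ x, 0 ≤ L (x * J x)) {x : A} {n : ℕ} (hx : ∀ g, L (x ^ n * g) = 0) (g : A) :
    L (x * g) = 0 := by
  have hsq : ∀ y : A, (∀ g, L (y ^ 2 * g) = 0) → ∀ g, L (y * g) = 0 := by
    intro y hy
    refine isotropic_mem_null hJJ hJc hpos ?_
    have h1 : L (y * J y * J (y * J y)) = 0 := by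
      have := hy (J y ^ 2)
      rw [J.map_mul, hJJ]
      convert this using 2
      ring
    simpa using isotropic_mem_null hJJ hJc hpos h1 1
  have htwo : ∀ k : ℕ, (∀ g, L (x ^ 2 ^ k * g) = 0) → ∀ g, L (x * g) = 0 := by
    intro k
    induction k with
    | zero => intro h; simpa using h
    | succ k ih =>
      intro h
      refine ih (hsq _ fun g => ?_)
      rw [← pow_mul, ← pow_succ]
      exact h g
  refine htwo n (fun g => ?_) g
  obtain ⟨m, hm⟩ := Nat.exists_eq_add_of_le (Nat.lt_two_pow_self (n := n)).le
  rw [hm, pow_add, mul_assoc]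
  exact hx _

/-- If `a - a*` is annihilated by `p p* + q q*` and `q` divides a power of `a a*`, then
`a - a*` lies in the null ideal of every positive functional. -/
theorem sub_star_null (hJJ : ∀ x, J (J x) = x) (hJc : ∀ (c : ℂ) x, J (c • x) = conj c • J x)
    (hpos : ∀ x, 0 ≤ L (x * J x)) {a p q t : A} {n : ℕ}
    (hpq : (a - J a) * (p * J p + q * J q) = 0) (hq : (a * J a) ^ n = q * t) (g : A) :
    L ((a - J a) * g) = 0 := by
  set h := a - J a with hh
  have h0 : L (h * q * J (h * q)) = 0 := by
    have e : h * p * J (h * p) + h * q * J (h * q) = 0 := by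
      simp only [map_mul]
      linear_combination J h * hpq
    have e' := congrArg L e
    rw [map_add, map_zero, add_eq_zero_iff_of_nonneg (hpos _) (hpos _)] at e'
    exact e'.2
  have h1 : ∀ g, L (h * q * g) = 0 := isotropic_mem_null hJJ hJc hpos h0
  have h2 : ∀ g, L (h * (a * J a) * g) = 0 := by
    refine null_of_pow_null hJJ hJc hpos (n := n + 1) fun g => ?_
    have e : (h * (a * J a)) ^ (n + 1) * g = h * q * (t * h ^ n * (a * J a) * g) := by
      rw [mul_pow, pow_succ (a * J a), hq]; ring
    rw [e, h1]
  have h3 : ∀ g, L (h * a * g) = 0 := by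
    refine isotropic_mem_null hJJ hJc hpos ?_
    have := h2 (J h)
    rw [J.map_mul]
    convert this using 2
    ring
  have h4 : ∀ g, L (h * J a * g) = 0 := by
    refine isotropic_mem_null hJJ hJc hpos ?_
    have := h2 (J h)
    rw [J.map_mul, hJJ]
    convert this using 2
    ring
  refine null_of_pow_null hJJ hJc hpos (n := 2) (fun g => ?_) g
  have e : h ^ 2 * g = h * a * g - h * J a * g := by rw [pow_two]; nth_rw 2 [hh]; ring
  rw [e, map_sub, h3, h4, sub_zero]

end NullIdeal

/-- Characters into `ℂ` of modulus one separate the points of an abelian group. -/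
theorem exists_unitary_character {K : Type*} [AddCommGroup K] {v : K} (hv : v ≠ 0) :
    ∃ χ : K → ℂ, (∀ a b, χ (a + b) = χ a * χ b) ∧ (∀ a, χ (-a) = conj (χ a)) ∧
      (∀ a, χ a ≠ 0) ∧ χ v ≠ 1 := by
  obtain ⟨c, hc⟩ := CharacterModule.exists_character_apply_ne_zero_of_ne_zero hv
  let i : AddCircle (1 : ℚ) →+ AddCircle (1 : ℝ) :=
    QuotientAddGroup.map _ _ (Rat.castHom ℝ).toAddMonoidHom (by
      rw [AddSubgroup.zmultiples_le]
      simp [AddSubgroup.mem_zmultiples])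
  have hi : ∀ x, i x = 0 → x = 0 := by
    intro x
    induction x using QuotientAddGroup.induction_on with
    | H x =>
      intro h
      have h' : ((x : ℝ) : AddCircle (1 : ℝ)) = 0 := h
      rw [AddCircle.coe_eq_zero_iff] at h'
      obtain ⟨n, hn⟩ := h'
      refine (AddCircle.coe_eq_zero_iff (1 : ℚ)).2 ⟨n, ?_⟩
      simp only [zsmul_eq_mul, mul_one] at hn ⊢
      exact_mod_cast hn
  refine ⟨fun k => ((i (c k)).toCircle : ℂ), ?_, ?_, ?_, ?_⟩
  · intro a b
    simp [AddCircle.toCircle_add]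
  · intro a
    simp only [map_neg, AddCircle.toCircle_neg, Circle.coe_inv_eq_conj]
  · intro a
    exact Circle.coe_ne_zero _
  · intro h
    apply hc
    apply hi
    apply AddCircle.injective_toCircle (one_ne_zero (α := ℝ))
    rw [AddCircle.toCircle_zero]
    exact Circle.ext (by simpa using h)

section Face

variable {S : Type*} [AddCommMonoid S] (st : S →+ S)

/-- The smallest face of `S` containing `u` and `u*`. -/
def starFace (u : S) : AddSubmonoid S where
  carrier := {s | ∃ t, ∃ n : ℕ, s + t = n • (u + st u)}
  zero_mem' := ⟨0, 0, by simp⟩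
  add_mem' := by
    rintro a b ⟨t, n, h⟩ ⟨t', n', h'⟩
    exact ⟨t + t', n + n', by rw [add_add_add_comm, h, h', add_smul]⟩

variable {st}

theorem starFace_of_add {u a b : S} (h : a + b ∈ starFace st u) : a ∈ starFace st u := by
  obtain ⟨t, n, h⟩ := h
  exact ⟨b + t, n, by rw [← add_assoc, h]⟩

theorem self_mem_starFace (u : S) : u ∈ starFace st u := ⟨st u, 1, by simp⟩

theorem starFace_star (hst : ∀ s, st (st s) = s) {u a : S} (h : a ∈ starFace st u) :
    st a ∈ starFace st u := by
  obtain ⟨t, n, h⟩ := h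
  exact ⟨st t, n, by rw [← map_add, h, map_nsmul, map_add, hst, add_comm (st u)]⟩

/-- Equality up to adding elements of the form `p + p*` in the face of `u`. -/
def normCon (st : S →+ S) (u : S) : AddCon (starFace st u) where
  r s t := ∃ p ∈ starFace st u, ∃ q ∈ starFace st u,
    (s : S) + (p + st p) = (t : S) + (q + st q)
  iseqv :=
    { refl := fun s => ⟨0, zero_mem _, 0, zero_mem _, rfl⟩
      symm := fun ⟨p, hp, q, hq, h⟩ => ⟨q, hq, p, hp, h.symm⟩
      trans := by
        rintro x y w ⟨p, hp, q, hq, h⟩ ⟨p', hp', q', hq', h'⟩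
        refine ⟨p + p', add_mem hp hp', q + q', add_mem hq hq', ?_⟩
        calc (x : S) + (p + p' + st (p + p')) = (x + (p + st p)) + (p' + st p') := by
              rw [map_add]; abel
          _ = (y + (p' + st p')) + (q + st q) := by rw [h]; abel
          _ = w + (q + q' + st (q + q')) := by rw [h', map_add]; abel }
  add' := by
    rintro x y x' y' ⟨p, hp, q, hq, h⟩ ⟨p', hp', q', hq', h'⟩
    refine ⟨p + p', add_mem hp hp', q + q', add_mem hq hq', ?_⟩
    calc ((x : S) + x') + (p + p' + st (p + p')) = (x + (p + st p)) + (x' + (p' + st p')) := by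
          rw [map_add]; abel
      _ = (y + y') + (q + q' + st (q + q')) := by rw [h, h', map_add]; abel

/-- If no character separates `u` from `u*`, then `u` and `u*` agree up to elements `p + p*`
of the face of `u`. -/
theorem exists_add_norm_eq (hst : ∀ s, st (st s) = s) {u : S}
    (hu : ∀ σ : S → ℂ, IsChar (· + ·) st σ → σ u = σ (st u)) :
    ∃ p ∈ starFace st u, ∃ q ∈ starFace st u, u + (p + st p) = st u + (q + st q) := by
  classical
  let Q := (normCon st u).Quotient
  have hneg : ∀ x : starFace st u,
      (normCon st u) (⟨st x, starFace_star hst x.2⟩ + x) 0 := fun x =>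
    ⟨0, zero_mem _, x, x.2, by simp [add_comm]⟩
  have hex : ∀ k : Q, ∃ l : Q, l + k = 0 := by
    intro k
    induction k using AddCon.induction_on with
    | H x => exact ⟨((⟨st x, starFace_star hst x.2⟩ : starFace st u) : Q), (AddCon.eq _).2 (hneg x)⟩
  choose inv hinv using hex
  let : Neg Q := ⟨inv⟩
  let : AddCommGroup Q :=
    { (inferInstance : AddCommMonoid Q) with
      zsmul := zsmulRec
      neg_add_cancel := hinv }
  let m : starFace st u → Q := fun x => (x : Q)
  have hmadd : ∀ x y, m (x + y) = m x + m y := fun x y => rfl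
  have hmst : ∀ x : starFace st u, m ⟨st x, starFace_star hst x.2⟩ = - m x := fun x =>
    eq_neg_of_add_eq_zero_left ((AddCon.eq _).2 (hneg x))
  let u' : starFace st u := ⟨u, self_mem_starFace u⟩
  let v' : starFace st u := ⟨st u, starFace_star hst u'.2⟩
  suffices h : m u' = m v' from (AddCon.eq (normCon st u)).1 h
  by_contra hne
  obtain ⟨χ, hadd, hconj, hnz, hχ⟩ := exists_unitary_character (sub_ne_zero.2 hne)
  let σ : S → ℂ := fun s => if h : s ∈ starFace st u then χ (m ⟨s, h⟩) else 0
  have hσ : ∀ (s : S) (h : s ∈ starFace st u), σ s = χ (m ⟨s, h⟩) := fun s h => dif_pos h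
  have hσ' : ∀ s : S, s ∉ starFace st u → σ s = 0 := fun s h => dif_neg h
  have hchar : IsChar (· + ·) st σ := by
    refine ⟨⟨u, ?_⟩, ?_, ?_⟩
    · rw [hσ u u'.2]
      exact hnz _
    · intro a b
      by_cases ha : a ∈ starFace st u
      · by_cases hb : b ∈ starFace st u
        · rw [hσ a ha, hσ b hb, hσ _ (add_mem ha hb), ← hadd]
          rfl
        · rw [hσ' b hb, mul_zero]
          exact hσ' _ fun h => hb (starFace_of_add (by rwa [add_comm b a]))
      · rw [hσ' a ha, zero_mul]
        exact hσ' _ fun h => ha (starFace_of_add h)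
    · intro a
      by_cases ha : a ∈ starFace st u
      · rw [hσ a ha, hσ _ (starFace_star hst ha), ← hconj, ← hmst]
      · rw [hσ' a ha, map_zero]
        exact hσ' _ fun h => ha (by simpa [hst] using starFace_star hst h)
  have h := hu σ hchar
  rw [hσ u u'.2, hσ _ v'.2] at h
  apply hχ
  have h1 := hadd (m u' - m v') (m v')
  rw [sub_add_cancel] at h1
  have h2 : χ (m u') = χ (m v') := h
  exact mul_right_cancel₀ (hnz (m v')) (by rw [← h1, one_mul, h2])

end Face

section Algebra

open AddMonoidAlgebra

variable {S : Type*}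

/-- The linear functional on `ℂ[S]` extending `φ`. -/
noncomputable def extendFn (φ : S → ℂ) : AddMonoidAlgebra ℂ S →ₗ[ℂ] ℂ where
  toFun x := Finsupp.linearCombination ℂ φ x.coeff
  map_add' x y := by simp
  map_smul' c x := by simp

@[simp]
theorem extendFn_single (φ : S → ℂ) (s : S) (c : ℂ) : extendFn φ (single s c) = c * φ s := by
  simp [extendFn]

variable [AddCommMonoid S]

/-- The conjugate-linear involution of `ℂ[S]` induced by an involution of `S`. -/
noncomputable def algStar (st : S →+ S) : AddMonoidAlgebra ℂ S →+* AddMonoidAlgebra ℂ S :=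
  (mapDomainRingHom ℂ st).comp (mapRingHom S (starRingEnd ℂ))

@[simp]
theorem algStar_single (st : S →+ S) (s : S) (c : ℂ) :
    algStar st (single s c) = single (st s) (conj c) := by
  simp [algStar]

theorem exists_eq_sum_single (x : AddMonoidAlgebra ℂ S) :
    ∃ (n : ℕ) (s : Fin n → S) (ξ : Fin n → ℂ), x = ∑ i, single (s i) (ξ i) := by
  induction x using AddMonoidAlgebra.induction_linear with
  | zero => exact ⟨0, 0, 0, by simp⟩
  | single s c => exact ⟨1, fun _ => s, fun _ => c, by simp⟩
  | add x y hx hy =>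
    obtain ⟨n, s, ξ, rfl⟩ := hx
    obtain ⟨m, t, η, rfl⟩ := hy
    exact ⟨n + m, Fin.append s t, Fin.append ξ η, by simp [Fin.sum_univ_add]⟩

/-- The extension of a positive definite function to `ℂ[S]` is a positive functional. -/
theorem extendFn_nonneg {st : S →+ S} {φ : S → ℂ} (hφ : IsPosDefFn (· + ·) st φ)
    (x : AddMonoidAlgebra ℂ S) : 0 ≤ extendFn φ (x * algStar st x) := by
  obtain ⟨n, s, ξ, rfl⟩ := exists_eq_sum_single x
  have h := hφ n s ξ
  simpa [Finset.sum_mul_sum, single_mul_single, add_comm] using h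

/-- The statement for additive monoids with a bundled involution. -/
theorem posDef_add_eq_conj {st : S →+ S} (hst : ∀ s, st (st s) = s) {u : S}
    (hu : ∀ σ : S → ℂ, IsChar (· + ·) st σ → σ u = σ (st u))
    {φ : S → ℂ} (hφ : IsPosDefFn (· + ·) st φ) (s : S) :
    φ (s + u) = conj (φ (st s + u)) := by
  have hJJ : ∀ x, algStar st (algStar st x) = x := by
    intro x
    induction x using AddMonoidAlgebra.induction_linear with
    | zero => simp
    | single s c => simp [hst]
    | add x y hx hy => rw [map_add, map_add, hx, hy]
  have hJc : ∀ (c : ℂ) x, algStar st (c • x) = conj c • algStar st x := by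
    intro c x
    induction x using AddMonoidAlgebra.induction_linear with
    | zero => simp
    | single s d => simp [smul_single]
    | add x y hx hy => rw [smul_add, map_add, map_add, hx, hy, smul_add]
  have hpos := extendFn_nonneg hφ
  obtain ⟨p, hp, q, ⟨t, n, hq⟩, hpq⟩ := exists_add_norm_eq hst hu
  have hpq' : st u + (p + st p) = u + (q + st q) := by
    have := congrArg st hpq
    simpa [hst, add_comm (st p), add_comm (st q)] using this
  have hnull := sub_star_null (L := extendFn φ) hJJ hJc hpos
    (a := single u 1) (p := single p 1) (q := single q 1) (t := single t 1) (n := n)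
    (by
      simp only [algStar_single, map_one, single_mul_single, mul_one, sub_mul, mul_add]
      rw [hpq, hpq']
      abel)
    (by simp [single_mul_single, single_pow, hq])
    (single s 1)
  have h1 : φ (u + s) = φ (st u + s) := by
    simpa [sub_mul, single_mul_single, sub_eq_zero] using hnull
  have hherm : ∀ w, φ (st w) = conj (φ w) := by
    intro w
    have key : ∀ c : ℂ, (c * φ w + conj c * φ (st w)).im = 0 := by
      intro c
      have h0 := (Complex.le_def.1 (hpos (single 0 1))).2
      have h2 := (Complex.le_def.1 (hpos (single w c))).2
      have h3 := (Complex.le_def.1 (hpos (single 0 1 + single w c))).2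
      simp only [map_add, mul_add, add_mul, algStar_single, single_mul_single, extendFn_single,
        map_zero, map_one, Complex.add_im, Complex.zero_im, add_zero, zero_add, one_mul,
        mul_one] at h0 h2 h3 ⊢
      linarith
    have h1 := key 1
    have h2 := key Complex.I
    simp at h1 h2
    apply Complex.ext <;> simp <;> linarith
  rw [← hherm, map_add, hst, add_comm s u, h1, add_comm]

end Algebra

/-- Let `S` be a commutative `*`-semigroup with a neutral element `0`, let `u ∈ S`
satisfy `σ(u) = σ(u*)` for every character `σ` on `S`, and let `φ : S → ℂ` be positive
definite.  Then `φ(s+u) = conj (φ(s* + u))` for all `s ∈ S`. -/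
theorem stmt14 {S : Type*} (add : S → S → S) (st : S → S)
    (hcomm : ∀ a b, add a b = add b a)
    (hassoc : ∀ a b c, add (add a b) c = add a (add b c))
    (hstadd : ∀ a b, st (add a b) = add (st a) (st b))
    (hstinv : ∀ a, st (st a) = a)
    (z : S) (hz : ∀ s, add z s = s)
    (u : S) (hu : ∀ σ : S → ℂ, IsChar add st σ → σ u = σ (st u))
    (φ : S → ℂ) (hφ : IsPosDefFn add st φ) :
    ∀ s : S, φ (add s u) = starRingEnd ℂ (φ (add (st s) u)) := by
  have hstz : st z = z := by
    have h := congrArg st (hz (st z))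
    rwa [hstadd, hstinv, hcomm, hz] at h
  let : Add S := ⟨add⟩
  let : Zero S := ⟨z⟩
  let : AddCommMonoid S :=
    { add_assoc := hassoc
      add_comm := hcomm
      zero_add := hz
      add_zero := fun a => (hcomm a z).trans (hz a)
      nsmul := nsmulRec }
  let st' : S →+ S := { toFun := st, map_zero' := hstz, map_add' := hstadd }
  exact posDef_add_eq_conj (st := st') hstinv hu hφ
end
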